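/- For every t ∈ [0,1), the operator C_t fails to be supercyclic, both as an operator on H^∞ and as an operator on A(𝔻): for no f in the space is the projective orbit {λ C_t^n f : λ ∈ ℂ, n ∈ ℕ₀} dense. -/

import Mathlib

open Complex MeasureTheory Metric Set Filter Topology

/-- The generalized Cesàro operator `C_t`, given by
`(C_t f)(z) = ∫_0^1 f(sz)/(1 - s t z) ds`, which equals `f(0)` at `z = 0` and
`(1/z)∫_0^z f(ξ)/(1 - tξ) dξ` for `z ≠ 0`. -/
noncomputable def cesaro (t : ℝ) (f : ℂ → ℂ) (z : ℂ) : ℂ :=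
  ∫ s in (0:ℝ)..1, f ((s : ℂ) * z) / (1 - (s : ℂ) * (t : ℂ) * z)

/-- The sup norm `‖f‖_∞ = sup_{z ∈ 𝔻} |f z|`. -/
noncomputable def supNorm (f : ℂ → ℂ) : ℝ :=
  sSup ((fun z => ‖f z‖) '' Metric.ball (0:ℂ) 1)

/-- Membership in `H^∞`: holomorphic and bounded on the open unit disc. -/
def MemHinf (f : ℂ → ℂ) : Prop :=
  DifferentiableOn ℂ f (Metric.ball (0:ℂ) 1) ∧
    BddAbove ((fun z => ‖f z‖) '' Metric.ball (0:ℂ) 1)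

/-- Membership in the disc algebra `A(𝔻)`: holomorphic on the open unit disc and
continuous on the closed unit disc (i.e. extends continuously to the closed disc). -/
def MemDiscAlg (f : ℂ → ℂ) : Prop :=
  DifferentiableOn ℂ f (Metric.ball (0:ℂ) 1) ∧ ContinuousOn f (Metric.closedBall (0:ℂ) 1)

/-- The factor `1 - t z` does not vanish on the unit disc. -/
lemma one_sub_mul_ne_zero {t : ℝ} (ht0 : 0 ≤ t) (ht1 : t < 1) {z : ℂ} (hz : z ∈ ball (0 : ℂ) 1) :
    1 - (t : ℂ) * z ≠ 0 := by
  intro h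
  have h1 : ‖(t : ℂ) * z‖ = 1 := by rw [← sub_eq_zero.mp h, norm_one]
  rw [norm_mul, Complex.norm_real, Real.norm_of_nonneg ht0] at h1
  rw [mem_ball_zero_iff] at hz
  nlinarith [norm_nonneg z]

lemma ofReal_mul_mem_ball {s : ℝ} (hs : s ∈ Icc (0 : ℝ) 1) {z : ℂ} (hz : z ∈ ball (0 : ℂ) 1) :
    (s : ℂ) * z ∈ ball (0 : ℂ) 1 := by
  rw [mem_ball_zero_iff] at hz ⊢
  rw [norm_mul, Complex.norm_real, Real.norm_of_nonneg hs.1]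
  nlinarith [norm_nonneg z, hs.1, hs.2]

/-- The integrand kernel `f(z) / (1 - t z)` is holomorphic on the disc. -/
lemma differentiableOn_div_one_sub {t : ℝ} (ht0 : 0 ≤ t) (ht1 : t < 1) {f : ℂ → ℂ}
    (hf : DifferentiableOn ℂ f (ball 0 1)) :
    DifferentiableOn ℂ (fun z => f z / (1 - (t : ℂ) * z)) (ball 0 1) :=
  hf.div (by fun_prop) fun _ hz => one_sub_mul_ne_zero ht0 ht1 hz

/-- On the disc, `C_t f` is the difference quotient at `0` of a primitive of `f(z) / (1 - t z)`. -/
lemma exists_cesaro_eqOn_dslope {t : ℝ} (ht0 : 0 ≤ t) (ht1 : t < 1) {f : ℂ → ℂ}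
    (hf : DifferentiableOn ℂ f (ball 0 1)) :
    ∃ G : ℂ → ℂ, (∀ z ∈ ball (0 : ℂ) 1, HasDerivAt G (f z / (1 - (t : ℂ) * z)) z) ∧
      EqOn (cesaro t f) (dslope G 0) (ball 0 1) := by
  have hF := differentiableOn_div_one_sub ht0 ht1 hf
  obtain ⟨G, hG⟩ := hF.isExactOn_ball
  refine ⟨G, hG, fun z hz => ?_⟩
  rcases eq_or_ne z 0 with rfl | hz0
  · rw [dslope_same, (hG 0 hz).deriv]
    simp [cesaro]
  · have hderiv : ∀ s ∈ uIcc (0 : ℝ) 1, HasDerivAt (fun s : ℝ => G ((s : ℂ) * z))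
        (f ((s : ℂ) * z) / (1 - (t : ℂ) * ((s : ℂ) * z)) * z) s := by
      intro s hs
      rw [uIcc_of_le zero_le_one] at hs
      have h1 : HasDerivAt (fun s : ℝ => (s : ℂ) * z) z s := by
        simpa using (Complex.ofRealCLM.hasDerivAt (x := s)).mul_const z
      exact (hG _ (ofReal_mul_mem_ball hs hz)).comp s h1
    have hcont : ContinuousOn
        (fun s : ℝ => f ((s : ℂ) * z) / (1 - (t : ℂ) * ((s : ℂ) * z)) * z) (uIcc 0 1) := by
      refine ContinuousOn.mul ?_ continuousOn_const
      refine hF.continuousOn.comp (f := fun s : ℝ => (s : ℂ) * z) (by fun_prop) fun s hs => ?_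
      rw [uIcc_of_le zero_le_one] at hs
      exact ofReal_mul_mem_ball hs hz
    have h := intervalIntegral.integral_eq_sub_of_hasDerivAt hderiv hcont.intervalIntegrable
    rw [intervalIntegral.integral_mul_const] at h
    have hc : cesaro t f z =
        ∫ s in (0 : ℝ)..1, f ((s : ℂ) * z) / (1 - (t : ℂ) * ((s : ℂ) * z)) := by
      refine intervalIntegral.integral_congr fun s _ => ?_
      rw [mul_comm (s : ℂ) (t : ℂ), mul_assoc]
    rw [dslope_of_ne _ hz0, slope_def_field, sub_zero, eq_div_iff hz0, hc, h]
    simp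

lemma differentiableOn_cesaro {t : ℝ} (ht0 : 0 ≤ t) (ht1 : t < 1) {f : ℂ → ℂ}
    (hf : DifferentiableOn ℂ f (ball 0 1)) : DifferentiableOn ℂ (cesaro t f) (ball 0 1) := by
  obtain ⟨G, hG, heq⟩ := exists_cesaro_eqOn_dslope ht0 ht1 hf
  refine DifferentiableOn.congr ?_ heq
  exact (Complex.differentiableOn_dslope (ball_mem_nhds 0 one_pos)).mpr
    fun z hz => (hG z hz).differentiableAt.differentiableWithinAt

lemma cesaro_apply_zero (t : ℝ) (f : ℂ → ℂ) : cesaro t f 0 = f 0 := by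
  simp [cesaro]

/-- The functional `f ↦ f'(0) - t f(0)` is an eigenvector of the dual of `C_t`. -/
lemma deriv_cesaro_zero_sub {t : ℝ} (ht0 : 0 ≤ t) (ht1 : t < 1) {f : ℂ → ℂ}
    (hf : DifferentiableOn ℂ f (ball 0 1)) :
    deriv (cesaro t f) 0 - t * cesaro t f 0 = (deriv f 0 - t * f 0) / 2 := by
  have hH := differentiableOn_cesaro ht0 ht1 hf
  obtain ⟨G, hG, heq⟩ := exists_cesaro_eqOn_dslope ht0 ht1 hf
  have hmem : (0 : ℂ) ∈ ball (0 : ℂ) 1 := mem_ball_self one_pos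
  have hmul : ∀ z ∈ ball (0 : ℂ) 1, z * cesaro t f z = G z - G 0 := by
    intro z hz
    rw [heq hz]
    simpa using sub_smul_dslope G 0 z
  have hfirst : ∀ z ∈ ball (0 : ℂ) 1,
      cesaro t f z + z * deriv (cesaro t f) z = f z / (1 - (t : ℂ) * z) := by
    intro z hz
    have hnhds := isOpen_ball.mem_nhds hz
    have h1 := (hasDerivAt_id z).mul (hH.differentiableAt hnhds).hasDerivAt
    have h2 : HasDerivAt (fun w => w * cesaro t f w) (f z / (1 - (t : ℂ) * z)) z :=
      ((hG z hz).sub_const (G 0)).congr_of_eventuallyEq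
        (Filter.eventuallyEq_of_mem hnhds hmul)
    simpa using h1.unique h2
  have hnhds := isOpen_ball.mem_nhds hmem
  have hdH := (hH.differentiableAt hnhds).hasDerivAt
  have hddH := ((hH.deriv isOpen_ball).differentiableAt hnhds).hasDerivAt
  have hdf := (hf.differentiableAt hnhds).hasDerivAt
  have h1 := hdH.add ((hasDerivAt_id (0 : ℂ)).mul hddH)
  have hden : HasDerivAt (fun z : ℂ => 1 - (t : ℂ) * z) (-(t : ℂ)) 0 := by
    simpa using ((hasDerivAt_id (0 : ℂ)).const_mul (t : ℂ)).const_sub 1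
  have h2 := (hdf.div hden (by simp)).congr_of_eventuallyEq
    (Filter.eventuallyEq_of_mem hnhds hfirst)
  have h := h1.unique h2
  simp at h
  rw [cesaro_apply_zero]
  linear_combination h / 2

lemma MemHinf.cesaro {t : ℝ} (ht0 : 0 ≤ t) (ht1 : t < 1) {f : ℂ → ℂ} (hf : MemHinf f) :
    MemHinf (cesaro t f) := by
  refine ⟨differentiableOn_cesaro ht0 ht1 hf.1, ?_⟩
  obtain ⟨M, hM⟩ := hf.2
  refine ⟨M / (1 - t), ?_⟩
  rintro _ ⟨z, hz, rfl⟩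
  have hbound : ∀ s ∈ uIoc (0 : ℝ) 1,
      ‖f ((s : ℂ) * z) / (1 - (s : ℂ) * (t : ℂ) * z)‖ ≤ M / (1 - t) := by
    intro s hs
    rw [uIoc_of_le zero_le_one] at hs
    have hsz := ofReal_mul_mem_ball ⟨hs.1.le, hs.2⟩ hz
    have hfz : ‖f ((s : ℂ) * z)‖ ≤ M := hM ⟨_, hsz, rfl⟩
    have hden : 1 - t ≤ ‖1 - (s : ℂ) * (t : ℂ) * z‖ := by
      have h1 := norm_sub_norm_le (1 : ℂ) ((s : ℂ) * (t : ℂ) * z)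
      have h2 : ‖(s : ℂ) * (t : ℂ) * z‖ = t * ‖(s : ℂ) * z‖ := by
        rw [mul_comm (s : ℂ), mul_assoc, norm_mul, Complex.norm_real, Real.norm_of_nonneg ht0]
      rw [mem_ball_zero_iff] at hsz
      rw [norm_one, h2] at h1
      nlinarith
    rw [norm_div]
    exact div_le_div₀ ((norm_nonneg _).trans hfz) hfz (by linarith) hden
  simpa [_root_.cesaro] using intervalIntegral.norm_integral_le_of_norm_le_const hbound

lemma MemHinf.iterate_cesaro {t : ℝ} (ht0 : 0 ≤ t) (ht1 : t < 1) {f : ℂ → ℂ} (hf : MemHinf f)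
    (n : ℕ) : MemHinf ((_root_.cesaro t)^[n] f) := by
  induction n with
  | zero => exact hf
  | succ n ih => rw [Function.iterate_succ_apply']; exact ih.cesaro ht0 ht1

lemma iterate_cesaro_apply_zero (t : ℝ) (f : ℂ → ℂ) (n : ℕ) : (cesaro t)^[n] f 0 = f 0 := by
  induction n with
  | zero => rfl
  | succ n ih => rw [Function.iterate_succ_apply', cesaro_apply_zero, ih]

lemma deriv_iterate_cesaro_zero_sub {t : ℝ} (ht0 : 0 ≤ t) (ht1 : t < 1) {f : ℂ → ℂ}
    (hf : MemHinf f) (n : ℕ) :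
    deriv ((cesaro t)^[n] f) 0 - t * f 0 = (deriv f 0 - t * f 0) / 2 ^ n := by
  induction n with
  | zero => simp
  | succ n ih =>
    have h := deriv_cesaro_zero_sub ht0 ht1 (hf.iterate_cesaro ht0 ht1 n).1
    rw [← Function.iterate_succ_apply' (cesaro t), iterate_cesaro_apply_zero, iterate_cesaro_apply_zero,
      ih] at h
    rw [h, div_div, pow_succ]

lemma MemHinf.norm_le_supNorm {f : ℂ → ℂ} (hf : MemHinf f) {z : ℂ} (hz : z ∈ ball (0 : ℂ) 1) :
    ‖f z‖ ≤ supNorm f :=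
  le_csSup hf.2 ⟨z, hz, rfl⟩

lemma MemHinf.norm_deriv_zero_le {f : ℂ → ℂ} (hf : MemHinf f) :
    ‖deriv f 0‖ ≤ 2 * supNorm f := by
  have hsub : closedBall (0 : ℂ) (1 / 2) ⊆ ball 0 1 := closedBall_subset_ball (by norm_num)
  have h := Complex.norm_deriv_le_of_forall_mem_sphere_norm_le (c := 0) (R := 1 / 2) (by norm_num)
    (hf.1.diffContOnCl_ball hsub)
    fun z hz => hf.norm_le_supNorm (hsub (sphere_subset_closedBall hz))
  linarith

lemma MemHinf.const_mul_sub {f g : ℂ → ℂ} (hf : MemHinf f) (hg : MemHinf g) (c : ℂ) :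
    MemHinf fun z => c * f z - g z := by
  refine ⟨(hf.1.const_mul c).sub hg.1, ?_⟩
  obtain ⟨M, hM⟩ := hf.2
  obtain ⟨N, hN⟩ := hg.2
  refine ⟨‖c‖ * M + N, ?_⟩
  rintro _ ⟨z, hz, rfl⟩
  calc ‖c * f z - g z‖ ≤ ‖c * f z‖ + ‖g z‖ := norm_sub_le _ _
    _ ≤ ‖c‖ * M + N := by
      rw [norm_mul]
      gcongr
      exacts [hM ⟨z, hz, rfl⟩, hN ⟨z, hz, rfl⟩]

lemma MemDiscAlg.memHinf {f : ℂ → ℂ} (hf : MemDiscAlg f) : MemHinf f :=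
  ⟨hf.1, ((isCompact_closedBall (0 : ℂ) 1).bddAbove_image hf.2.norm).mono
    (image_mono ball_subset_closedBall)⟩

lemma memDiscAlg_one_add_mul (b : ℂ) : MemDiscAlg fun z => 1 + b * z :=
  ⟨by fun_prop, by fun_prop⟩

/-- Some affine function stays at distance at least `1/2` from the projective orbit of `f`. -/
lemma exists_affine_half_le_supNorm {t : ℝ} (ht0 : 0 ≤ t) (ht1 : t < 1) {f : ℂ → ℂ}
    (hf : MemHinf f) :
    ∃ b : ℂ, ∀ (c : ℂ) (n : ℕ),
      1 / 2 ≤ supNorm fun z => c * (cesaro t)^[n] f z - (1 + b * z) := by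
  set v : ℂ := deriv f 0 - t * f 0 with hv
  set r : ℝ := 2 + 2 * (‖v‖ / ‖f 0‖) with hr
  refine ⟨t + (r : ℂ), fun c n => ?_⟩
  by_contra! hlt
  set F := (cesaro t)^[n] f with hF
  have hFm : MemHinf F := hf.iterate_cesaro ht0 ht1 n
  have hh := hFm.const_mul_sub (memDiscAlg_one_add_mul (t + (r : ℂ))).memHinf c
  have hmem : (0 : ℂ) ∈ ball (0 : ℂ) 1 := mem_ball_self one_pos
  have h0 := (hh.norm_le_supNorm hmem).trans hlt.le
  have h1 := hh.norm_deriv_zero_le.trans (mul_le_mul_of_nonneg_left hlt.le zero_le_two)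
  have hd : deriv (fun z => c * F z - (1 + (t + (r : ℂ)) * z)) 0
      = c * deriv F 0 - (t + (r : ℂ)) := by
    have ha := (hFm.1.differentiableAt (isOpen_ball.mem_nhds hmem)).hasDerivAt.const_mul c
    have hb := ((hasDerivAt_id (0 : ℂ)).const_mul (t + (r : ℂ))).const_add 1
    simpa [Pi.sub_def] using (ha.sub hb).deriv
  rw [hd] at h1
  simp only [hF, iterate_cesaro_apply_zero, mul_zero, add_zero] at h0
  have hiter := deriv_iterate_cesaro_zero_sub ht0 ht1 hf n
  rw [← hF, ← hv] at hiter
  have hcu : ‖c‖ * ‖f 0‖ ≤ 3 / 2 := by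
    rw [← norm_mul]
    have := norm_le_norm_sub_add (c * f 0) 1
    rw [norm_one] at this
    linarith
  have hf0 : 0 < ‖f 0‖ := by
    rcases (norm_nonneg (f 0)).eq_or_lt with h | h
    · rw [norm_eq_zero.mp h.symm] at h0
      norm_num at h0
    · exact h
  have hrpos : 0 ≤ r := by positivity
  have hkey : (r : ℂ) = c * (v / 2 ^ n) + t * (c * f 0 - 1) - (c * deriv F 0 - (t + (r : ℂ))) := by
    rw [← hiter]; ring
  have hnorm : r ≤ ‖c‖ * ‖v‖ + 1 / 2 + 1 := by
    calc r = ‖(r : ℂ)‖ := by rw [Complex.norm_real, Real.norm_of_nonneg hrpos]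
      _ ≤ ‖c * (v / 2 ^ n)‖ + ‖(t : ℂ) * (c * f 0 - 1)‖ + ‖c * deriv F 0 - (t + (r : ℂ))‖ := by
        refine (congrArg norm hkey).trans_le ((norm_sub_le _ _).trans ?_)
        gcongr
        exact norm_add_le _ _
      _ ≤ ‖c‖ * ‖v‖ + 1 / 2 + 1 := by
        have hva : ‖c * (v / 2 ^ n)‖ ≤ ‖c‖ * ‖v‖ := by
          rw [norm_mul, norm_div, norm_pow, Complex.norm_ofNat]
          gcongr
          exact div_le_self (norm_nonneg v) (one_le_pow₀ one_le_two)
        have hta : ‖(t : ℂ) * (c * f 0 - 1)‖ ≤ 1 / 2 := by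
          rw [norm_mul, Complex.norm_real, Real.norm_of_nonneg ht0]
          nlinarith [norm_nonneg (c * f 0 - 1)]
        linarith
  have hcv : ‖c‖ * ‖v‖ ≤ 3 / 2 * (‖v‖ / ‖f 0‖) := by
    calc ‖c‖ * ‖v‖ = ‖c‖ * ‖f 0‖ * (‖v‖ / ‖f 0‖) := by field_simp
      _ ≤ 3 / 2 * (‖v‖ / ‖f 0‖) := by gcongr
  have hq : 0 ≤ ‖v‖ / ‖f 0‖ := by positivity
  linarith

/-- For each `t ∈ [0,1)`, the operator `C_t` is not supercyclic on `H^∞` nor on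
`A(𝔻)`: for no `f` in the space is the projective orbit `{λ C_t^n f : λ ∈ ℂ, n ∈ ℕ₀}`
dense in the space (w.r.t. the sup norm). -/
theorem cesaro_not_supercyclic_Hinf_discAlg (t : ℝ) (ht0 : 0 ≤ t) (ht1 : t < 1) :
    (∀ f, MemHinf f →
      ¬ (∀ g, MemHinf g → ∀ ε > (0:ℝ), ∃ (c : ℂ) (n : ℕ),
          supNorm (fun z => c * ((cesaro t)^[n] f) z - g z) < ε)) ∧
    (∀ f, MemDiscAlg f →
      ¬ (∀ g, MemDiscAlg g → ∀ ε > (0:ℝ), ∃ (c : ℂ) (n : ℕ),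
          supNorm (fun z => c * ((cesaro t)^[n] f) z - g z) < ε)) := by
  refine ⟨fun f hf hdense => ?_, fun f hf hdense => ?_⟩
  · obtain ⟨b, hb⟩ := exists_affine_half_le_supNorm ht0 ht1 hf
    obtain ⟨c, n, h⟩ := hdense _ (memDiscAlg_one_add_mul b).memHinf (1 / 2) one_half_pos
    exact (hb c n).not_gt h
  · obtain ⟨b, hb⟩ := exists_affine_half_le_supNorm ht0 ht1 hf.memHinf
    obtain ⟨c, n, h⟩ := hdense _ (memDiscAlg_one_add_mul b) (1 / 2) one_half_pos
    exact (hb c n).not_gt h
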